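/- Let K be an algebraically closed field of characteristic zero, let n ≥ 2 be an integer, and set M = 2·n²·(n+1)·C(3n−1, n). Let F(t) = t^n + a_{n−1}·t^{n−1} + ⋯ + a_1·t + a_0 ∈ (K[x])[t] be a monic polynomial of degree n with coefficients a_i ∈ K[x]. If there are at least M values λ ∈ K such that the polynomial F(λ) ∈ K[x] is nonzero and n-powerful (every root of F(λ) in K has multiplicity at least n), then either all the coefficients a_0, …, a_{n−1} lie in K, or there exists ν ∈ K[x] such that F(t) = (t + ν)^n. -/

import Mathlib

open Polynomial

/-- A nonzero polynomial `f` is `n`-powerful if every root of `f` has multiplicity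
at least `n`. -/
def Polynomial.IsNPowerful {K : Type*} [Field K] (n : ℕ) (f : Polynomial K) : Prop :=
  ∀ a : K, f.eval a = 0 → n ≤ f.rootMultiplicity a

namespace Polynomial

/-- Differentiation of the coefficients of a polynomial over `K[X]`. -/
noncomputable def coeffDeriv (K : Type*) [Field K] : Derivation K K[X][X] K[X][X] :=
  PolynomialModule.equivPolynomialSelf.compDer (derivative' : Derivation K K[X] K[X]).mapCoeffs

section

variable {K : Type*} [Field K]

@[simp]
lemma coeff_coeffDeriv (p : K[X][X]) (i : ℕ) :
    (coeffDeriv K p).coeff i = derivative (p.coeff i) := rfl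

lemma natDegree_coeffDeriv_le (p : K[X][X]) : (coeffDeriv K p).natDegree ≤ p.natDegree := by
  refine natDegree_le_iff_coeff_eq_zero.mpr fun i hi => ?_
  simp [coeff_eq_zero_of_natDegree_lt hi]

lemma eval_C_coeffDeriv (p : K[X][X]) (c : K) :
    (coeffDeriv K p).eval (C c) = derivative (p.eval (C c)) := by
  rw [eval_eq_sum_range' (Nat.lt_succ_of_le (natDegree_coeffDeriv_le p)), eval_eq_sum_range,
    derivative_sum]
  refine Finset.sum_congr rfl fun i _ => ?_
  simp [← C_pow, -map_pow]

/-- A monic polynomial dividing its coefficientwise derivative has zero coefficientwise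
derivative. -/
lemma Monic.coeffDeriv_eq_zero_of_dvd {p : K[X][X]} (hp : p.Monic) (h : p ∣ coeffDeriv K p) :
    coeffDeriv K p = 0 := by
  by_contra hne
  have hle := natDegree_le_of_dvd h hne
  have hlc : (coeffDeriv K p).coeff (coeffDeriv K p).natDegree = 0 := by
    rw [le_antisymm (natDegree_coeffDeriv_le p) hle, coeff_coeffDeriv, hp.coeff_natDegree,
      derivative_one]
  exact hne (leadingCoeff_eq_zero.mp hlc)

lemma natDegree_resultant_le {f g : K[X][X]} {d : ℕ} (hf : ∀ i, (f.coeff i).natDegree ≤ d)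
    (hg : ∀ i, (g.coeff i).natDegree ≤ d) (m n : ℕ) :
    (resultant f g m n).natDegree ≤ (m + n) * d := by
  have hentry : ∀ i j, (sylvester f g m n i j).natDegree ≤ d := by
    intro i j
    induction j using Fin.addCases with
    | left j =>
      simp only [sylvester, Matrix.of_apply, Fin.addCases_left]
      split_ifs <;> simp [hg]
    | right j =>
      simp only [sylvester, Matrix.of_apply, Fin.addCases_right]
      split_ifs <;> simp [hf]
  rw [resultant, Matrix.det_apply]
  refine natDegree_sum_le_of_forall_le _ _ fun σ _ => ?_
  refine (natDegree_smul_le _ _).trans <| (natDegree_prod_le _ _).trans ?_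
  exact (Finset.sum_le_card_nsmul _ _ d fun i _ => hentry _ _).trans (by simp)

/-- A product of distinct monic irreducible polynomials over `K[X]`, none of which has constant
coefficients, is coprime over `K(X)` to its coefficientwise derivative. -/
lemma resultant_prod_coeffDeriv_ne_zero (T : Finset K[X][X])
    (hmonic : ∀ P ∈ T, P.Monic) (hirr : ∀ P ∈ T, Irreducible P)
    (hderiv : ∀ P ∈ T, coeffDeriv K P ≠ 0) :
    resultant (∏ P ∈ T, P) (coeffDeriv K (∏ P ∈ T, P)) ≠ 0 := by
  classical
  intro hres
  set φ := algebraMap K[X] (FractionRing K[X])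
  have hφ : Function.Injective φ := IsFractionRing.injective _ _
  have hR : (∏ P ∈ T, P).Monic := monic_prod_of_monic _ _ hmonic
  have hres' : resultant ((∏ P ∈ T, P).map φ) ((coeffDeriv K (∏ P ∈ T, P)).map φ) = 0 := by
    rw [natDegree_map_eq_of_injective hφ, natDegree_map_eq_of_injective hφ, resultant_map_map,
      hres, map_zero]
  have hncop := (resultant_eq_zero_iff.mp hres').2
  rw [← EuclideanDomain.gcd_isUnit_iff] at hncop
  obtain ⟨q, hq, hqdvd⟩ := WfDvdMonoid.exists_irreducible_factor hncop
    (fun h0 => (hR.map φ).ne_zero (EuclideanDomain.gcd_eq_zero_iff.mp h0).1)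
  have hqR := hqdvd.trans (EuclideanDomain.gcd_dvd_left _ _)
  have hqR' := hqdvd.trans (EuclideanDomain.gcd_dvd_right _ _)
  rw [Polynomial.map_prod, hq.prime.dvd_finsetProd_iff] at hqR
  obtain ⟨P, hP, hqP⟩ := hqR
  have hPirr : Irreducible (P.map φ) :=
    ((hmonic P hP).irreducible_iff_irreducible_map_fraction_map).mp (hirr P hP)
  have hPdvd : P ∣ coeffDeriv K (∏ P ∈ T, P) :=
    (map_dvd_map φ hφ (hmonic P hP)).mp
      (((hq.associated_of_dvd hPirr hqP).symm.dvd).trans hqR')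
  have hPprime : Prime P := (hirr P hP).prime
  rw [← Finset.mul_prod_erase T (fun P => P) hP, Derivation.leibniz, smul_eq_mul, smul_eq_mul,
    dvd_add_right (dvd_mul_right _ _)] at hPdvd
  rcases hPprime.dvd_or_dvd hPdvd with h | h
  · obtain ⟨Q, hQ, hPQ⟩ := (hPprime.dvd_finsetProd_iff _).mp h
    obtain ⟨hne, hQT⟩ := Finset.mem_erase.mp hQ
    exact hne (eq_of_monic_of_associated (hmonic Q hQT) (hmonic P hP)
      ((hirr P hP).associated_of_dvd (hirr Q hQT) hPQ).symm)
  · exact hderiv P hP ((hmonic P hP).coeffDeriv_eq_zero_of_dvd h)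

/-- The specializations of a bivariate polynomial at constants all have the generic degree,
with at most `natDegree` many exceptions. -/
lemma card_filter_coeff_eval_eq_zero_le [DecidableEq K] {R : K[X][X]} {d i : ℕ}
    (hi : (R.coeff i).coeff d ≠ 0) (B : Finset K) :
    (B.filter fun c => (R.eval (C c)).coeff d = 0).card ≤ R.natDegree := by
  set Q : K[X] := ∑ j ∈ Finset.range (R.natDegree + 1), monomial j ((R.coeff j).coeff d)
  have hQcoeff : Q.coeff i ≠ 0 := by
    have hmem : i < R.natDegree + 1 :=
      Nat.lt_succ_of_le (le_natDegree_of_ne_zero fun h => hi (by simp [h]))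
    simpa [Q, finsetSum_coeff, coeff_monomial, hmem] using hi
  have hQ : Q ≠ 0 := fun h => hQcoeff (by simp [h])
  have hQeval : ∀ c, Q.eval c = (R.eval (C c)).coeff d := fun c => by
    simp [Q, eval_finsetSum, eval_eq_sum_range (p := R), finsetSum_coeff, ← C_pow, -map_pow]
  have hQdeg : Q.natDegree ≤ R.natDegree :=
    natDegree_sum_le_of_forall_le _ _ fun j hj =>
      (natDegree_monomial_le _).trans (Nat.lt_succ_iff.mp (Finset.mem_range.mp hj))
  refine le_trans ?_ hQdeg
  refine card_le_degree_of_subset_roots (p := Q) fun c hc => ?_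
  rw [mem_roots hQ, IsRoot, hQeval]
  exact (Finset.mem_filter.mp hc).2

/-- A monic polynomial over `K[X]` has at most `natDegree` many constants at which its value
vanishes at a given point. -/
lemma Monic.card_filter_eval_eval_eq_zero_le [DecidableEq K] {R : K[X][X]} (hR : R.Monic) (x : K)
    (B : Finset K) : (B.filter fun c => (R.eval (C c)).eval x = 0).card ≤ R.natDegree := by
  have hne : R.map (evalRingHom x) ≠ 0 := (hR.map _).ne_zero
  rw [← hR.natDegree_map (evalRingHom x)]
  refine card_le_degree_of_subset_roots (p := R.map (evalRingHom x)) fun c hc => ?_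
  rw [mem_roots hne, IsRoot]
  have := (Finset.mem_filter.mp hc).2
  rw [← coe_evalRingHom, ← eval_map_apply] at this
  simpa using this

/-- If `R` is coprime to its coefficientwise derivative, then the order of vanishing of a
specialization of `R` exceeds that of the resultant by at most one. -/
lemma rootMultiplicity_eval_C_sub_one_le {R : K[X][X]} (hs : R.natDegree ≠ 0)
    (hres : resultant R (coeffDeriv K R) ≠ 0) (c x : K) :
    (R.eval (C c)).rootMultiplicity x - 1 ≤
      (resultant R (coeffDeriv K R)).rootMultiplicity x := by
  obtain ⟨p, q, -, -, h⟩ := exists_mul_add_mul_eq_C_resultant R (coeffDeriv K R) le_rfl le_rfl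
    (Or.inl hs)
  have h' := congrArg (eval (C c)) h
  rw [eval_add, eval_mul, eval_mul, eval_C_coeffDeriv, eval_C] at h'
  rw [le_rootMultiplicity_iff hres, ← h']
  have hdvd := pow_rootMultiplicity_dvd (R.eval (C c)) x
  refine dvd_add (Dvd.dvd.mul_right ((pow_dvd_pow _ (Nat.sub_le _ _)).trans hdvd) _)
    (Dvd.dvd.mul_right ?_ _)
  exact pow_sub_one_dvd_derivative_of_pow_dvd hdvd

/-- If `R` is monic, coprime to its coefficientwise derivative and not constant in `X`, then few
of its specializations at constants can have only multiple roots. -/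
lemma Monic.card_le_of_isNPowerful_two [IsAlgClosed K] {R : K[X][X]} (hR : R.Monic)
    (hderiv : coeffDeriv K R ≠ 0) (hres : resultant R (coeffDeriv K R) ≠ 0) (B : Finset K)
    (hB : ∀ c ∈ B, IsNPowerful 2 (R.eval (C c))) :
    B.card ≤ R.natDegree + 4 * R.natDegree ^ 2 := by
  classical
  set D := resultant R (coeffDeriv K R)
  set s := R.natDegree
  have hs0 : s ≠ 0 := fun h => hderiv <| by
    rw [hR.natDegree_eq_zero.mp h, Derivation.map_one_eq_zero]
  obtain ⟨i, hi, hid⟩ := Finset.exists_mem_eq_sup R.support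
    (support_nonempty.mpr hR.ne_zero) (fun i => (R.coeff i).natDegree)
  set d := R.support.sup fun i => (R.coeff i).natDegree
  have hle : ∀ j, (R.coeff j).natDegree ≤ d := fun j => by
    by_cases hj : R.coeff j = 0
    · simp [hj]
    · exact Finset.le_sup (f := fun i => (R.coeff i).natDegree) (mem_support_iff.mpr hj)
  have hd : 0 < d := by
    refine Nat.pos_of_ne_zero fun h => hderiv <| ext fun j => ?_
    rw [coeff_coeffDeriv, derivative_of_natDegree_zero (Nat.le_zero.mp (h ▸ hle j)), coeff_zero]
  have hDdeg : D.natDegree ≤ 2 * s * d :=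
    (natDegree_resultant_le hle (g := coeffDeriv K R)
      (fun j => (natDegree_derivative_le _).trans ((Nat.sub_le _ _).trans (hle j))) _ _).trans
      (Nat.mul_le_mul_right _ (by have := natDegree_coeffDeriv_le R; omega))
  have hlead : (R.coeff i).coeff d ≠ 0 := by
    rw [hid]
    exact leadingCoeff_ne_zero.mpr (mem_support_iff.mp hi)
  set B' := B.filter fun c => ¬ (R.eval (C c)).coeff d = 0
  have hcard : B.card ≤ s + B'.card := by
    rw [← Finset.card_filter_add_card_filter_not (s := B) fun c => (R.eval (C c)).coeff d = 0]
    exact Nat.add_le_add_right (card_filter_coeff_eval_eq_zero_le hlead B) _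
  have hne : ∀ c ∈ B', R.eval (C c) ≠ 0 := fun c hc h =>
    (Finset.mem_filter.mp hc).2 (by simp [h])
  have hprod : ∏ c ∈ B', R.eval (C c) ≠ 0 := Finset.prod_ne_zero_iff.mpr hne
  have hroots : (∏ c ∈ B', R.eval (C c)).roots ≤ (D ^ (2 * s)).roots := by
    rw [Multiset.le_iff_count]
    intro x
    rw [roots_prod _ _ hprod, Multiset.count_bind, roots_pow, Multiset.count_nsmul, count_roots]
    simp only [count_roots]
    change ∑ c ∈ B', (R.eval (C c)).rootMultiplicity x ≤ _
    rw [← Finset.sum_filter_of_ne (p := fun c => (R.eval (C c)).eval x = 0)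
      (fun c _ h => by_contra fun hx => h (rootMultiplicity_eq_zero hx))]
    calc _ ≤ (B'.filter fun c => (R.eval (C c)).eval x = 0).card •
          (2 * D.rootMultiplicity x) := by
          refine Finset.sum_le_card_nsmul _ _ _ fun c hc => ?_
          obtain ⟨hc', hx⟩ := Finset.mem_filter.mp hc
          have h2 := hB c (Finset.mem_filter.mp hc').1 x hx
          have h1 : _ ≤ D.rootMultiplicity x := rootMultiplicity_eval_C_sub_one_le hs0 hres c x
          omega
      _ ≤ s • (2 * D.rootMultiplicity x) :=
          nsmul_le_nsmul_left (Nat.zero_le _) (hR.card_filter_eval_eval_eq_zero_le x B')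
      _ = _ := by rw [smul_eq_mul]; ring
  have hdeg := Multiset.card_le_card hroots
  rw [← (IsAlgClosed.splits _).natDegree_eq_card_roots,
    ← (IsAlgClosed.splits _).natDegree_eq_card_roots, natDegree_prod _ _ hne,
    Polynomial.natDegree_pow] at hdeg
  have hlow : B'.card * d ≤ ∑ c ∈ B', (R.eval (C c)).natDegree := by
    rw [← smul_eq_mul]
    exact Finset.card_nsmul_le_sum _ _ _ fun c hc =>
      le_natDegree_of_ne_zero (Finset.mem_filter.mp hc).2
  have : B'.card * d ≤ (4 * s ^ 2) * d := by nlinarith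
  exact hcard.trans (Nat.add_le_add_left (Nat.le_of_mul_le_mul_right this hd) _)

end

/-- A monic polynomial over a domain is a product of monic irreducible polynomials. -/
lemma Monic.exists_multiset_prod_eq {R : Type*} [CommRing R] [IsDomain R] (f : R[X])
    (hf : f.Monic) :
    ∃ S : Multiset R[X], (∀ P ∈ S, P.Monic ∧ Irreducible P) ∧ S.prod = f := by
  induction h : f.natDegree using Nat.strong_induction_on generalizing f with
  | _ m ih =>
    subst h
    by_cases h1 : f = 1
    · exact ⟨0, by simp, by simp [h1]⟩
    by_cases hirr : Irreducible f
    · exact ⟨{f}, by simp [hf, hirr], by simp⟩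
    rw [hf.irreducible_iff_natDegree] at hirr
    push Not at hirr
    obtain ⟨g, k, hg, hk, hgk, hg0, hk0⟩ := hirr h1
    have hdeg : g.natDegree + k.natDegree = f.natDegree := by rw [← hgk, hg.natDegree_mul hk]
    obtain ⟨S, hS, hSp⟩ := ih _ (by omega) g hg rfl
    obtain ⟨S', hS', hSp'⟩ := ih _ (by omega) k hk rfl
    refine ⟨S + S', fun P hP => ?_, by rw [Multiset.prod_add, hSp, hSp', hgk]⟩
    exact (Multiset.mem_add.mp hP).elim (hS P) (hS' P)

/-- If a product of powers with exponents less than `n` is `n`-powerful, then the product of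
the bases is `2`-powerful. -/
lemma isNPowerful_two_of_prod_pow {K ι : Type*} [Field K] {n : ℕ} (T : Finset ι) (g : ι → K[X])
    (e : ι → ℕ) (he : ∀ i ∈ T, 0 < e i ∧ e i < n) (u : K) (h0 : C u * ∏ i ∈ T, g i ^ e i ≠ 0)
    (h : IsNPowerful n (C u * ∏ i ∈ T, g i ^ e i)) : IsNPowerful 2 (∏ i ∈ T, g i) := by
  classical
  intro x hx
  have hg : ∀ i ∈ T, g i ≠ 0 := fun i hi => by
    have := Finset.prod_ne_zero_iff.mp (right_ne_zero_of_mul h0) i hi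
    exact ne_zero_pow (he i hi).1.ne' this
  have hu : u ≠ 0 := fun h => h0 (by simp [h])
  have hmul : ∀ f : ι → K[X], (∀ i ∈ T, f i ≠ 0) →
      (∏ i ∈ T, f i).rootMultiplicity x = ∑ i ∈ T, (f i).rootMultiplicity x := fun f hf => by
    rw [← count_roots, roots_prod _ _ (Finset.prod_ne_zero_iff.mpr hf), Multiset.count_bind]
    simp only [count_roots]
    rfl
  have hx' : (C u * ∏ i ∈ T, g i ^ e i).eval x = 0 := by
    rw [eval_prod, Finset.prod_eq_zero_iff] at hx
    obtain ⟨i, hi, hix⟩ := hx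
    rw [eval_mul, eval_prod, Finset.prod_eq_zero hi (by simp [hix, (he i hi).1.ne']), mul_zero]
  have hn := h x hx'
  rw [← count_roots, roots_C_mul _ hu, count_roots,
    hmul _ fun i hi => pow_ne_zero _ (hg i hi)] at hn
  rw [hmul g hg]
  have hle : ∑ i ∈ T, (g i ^ e i).rootMultiplicity x ≤
      (n - 1) * ∑ i ∈ T, (g i).rootMultiplicity x := by
    rw [Finset.mul_sum]
    refine Finset.sum_le_sum fun i hi => ?_
    rw [← count_roots, roots_pow, Multiset.count_nsmul, count_roots]
    exact Nat.mul_le_mul_right _ (Nat.le_sub_one_of_lt (he i hi).2)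
  by_contra! hlt
  have hpos : 0 < n := by
    rw [eval_prod, Finset.prod_eq_zero_iff] at hx
    obtain ⟨i, hi, -⟩ := hx
    exact (Nat.zero_le _).trans_lt (he i hi).2
  have : (n - 1) * ∑ i ∈ T, (g i).rootMultiplicity x ≤ n - 1 :=
    (Nat.mul_le_mul_left _ (Nat.le_of_lt_succ hlt)).trans (mul_one _).le
  omega

/-- A monic polynomial of degree `n` divisible by the `n`-th power of a nonconstant monic polynomial
is the `n`-th power of a linear polynomial. -/
lemma Monic.exists_eq_X_add_C_pow {R : Type*} [CommRing R] [IsDomain R] {F P : R[X]}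
    (hF : F.Monic) {n : ℕ} (hn : F.natDegree = n) (hP : P.Monic) (hpos : 0 < P.natDegree)
    (hdvd : P ^ n ∣ F) : ∃ ν : R, F = (X + C ν) ^ n := by
  rcases n.eq_zero_or_pos with rfl | hn0
  · exact ⟨0, by rw [hF.natDegree_eq_zero.mp hn, pow_zero]⟩
  have hle := natDegree_le_of_dvd hdvd hF.ne_zero
  rw [hP.natDegree_pow, hn] at hle
  have hP1 : P.natDegree = 1 :=
    le_antisymm (Nat.le_of_mul_le_mul_left (by simpa using hle) hn0) hpos
  refine ⟨P.coeff 0, ?_⟩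
  rw [← hP.eq_X_add_C hP1]
  exact eq_of_monic_of_dvd_of_natDegree_le (hP.pow n) hF hdvd
    (by rw [hP.natDegree_pow, hP1, hn, mul_one])

/-- If a monic polynomial `F` of degree `n` over `K[X]` has more than `5 * n ^ 2` nonzero
`n`-powerful specializations at constants, then either its coefficients are constant or it is the
`n`-th power of a linear polynomial. -/
lemma Monic.coeffDeriv_eq_zero_or_eq_pow {K : Type*} [Field K] [IsAlgClosed K] [CharZero K]
    {F : K[X][X]}
    (hF : F.Monic) {n : ℕ} (hn : F.natDegree = n) (B : Finset K) (hB : 5 * n ^ 2 < B.card)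
    (hpow : ∀ c ∈ B, F.eval (C c) ≠ 0 ∧ IsNPowerful n (F.eval (C c))) :
    coeffDeriv K F = 0 ∨ ∃ ν : K[X], F = (X + C ν) ^ n := by
  classical
  obtain ⟨S, hS, rfl⟩ := hF.exists_multiset_prod_eq
  set T := S.toFinset.filter fun P => coeffDeriv K P ≠ 0
  set T₀ := S.toFinset.filter fun P => ¬ coeffDeriv K P ≠ 0
  have hTS : ∀ P ∈ T, P ∈ S := fun P hP => Multiset.mem_toFinset.mp (Finset.mem_filter.mp hP).1
  have hprod : S.prod = (∏ P ∈ T₀, P ^ S.count P) * ∏ P ∈ T, P ^ S.count P := by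
    rw [Finset.prod_multiset_count, mul_comm, Finset.prod_filter_mul_prod_filter_not]
  have hconst : coeffDeriv K (∏ P ∈ T₀, P ^ S.count P) = 0 := by
    refine Finset.prod_induction _ (fun p => coeffDeriv K p = 0)
      (fun p q hp hq => by simp [Derivation.leibniz, hp, hq]) (Derivation.map_one_eq_zero _)
      fun P hP => ?_
    have : coeffDeriv K P = 0 := not_not.mp (Finset.mem_filter.mp hP).2
    simp [Derivation.leibniz_pow, this]
  rcases T.eq_empty_or_nonempty with hTe | ⟨P₀, hP₀⟩
  · left
    rw [hprod, hTe, Finset.prod_empty, mul_one, hconst]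
  right
  have hTm : ∀ P ∈ T, P.Monic := fun P hP => (hS P (hTS P hP)).1
  have hTi : ∀ P ∈ T, Irreducible P := fun P hP => (hS P (hTS P hP)).2
  have hTd : ∀ P ∈ T, coeffDeriv K P ≠ 0 := fun P hP => (Finset.mem_filter.mp hP).2
  have hSirr : ∀ P ∈ T, 0 < P.natDegree := fun P hP =>
    (hTm P hP).natDegree_pos.mpr (hTi P hP).ne_one
  by_cases hcount : ∃ P ∈ T, n ≤ S.count P
  · obtain ⟨P, hP, hnP⟩ := hcount
    have hdvd : P ^ n ∣ S.prod := by
      refine (pow_dvd_pow P hnP).trans ?_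
      rw [hprod]
      exact Dvd.dvd.mul_left (Finset.dvd_prod_of_mem (fun P => P ^ S.count P) hP) _
    exact hF.exists_eq_X_add_C_pow hn (hTm P hP) (hSirr P hP) hdvd
  push Not at hcount
  exfalso
  have hRm : (∏ P ∈ T, P).Monic := monic_prod_of_monic _ _ hTm
  have hres := resultant_prod_coeffDeriv_ne_zero T hTm hTi hTd
  have hRdvd : (∏ P ∈ T, P) ∣ S.prod := by
    rw [hprod]
    refine Dvd.dvd.mul_left (Finset.prod_dvd_prod_of_dvd _ _ fun P hP => ?_) _
    exact dvd_pow_self _ (Multiset.count_pos.mpr (hTS P hP)).ne'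
  have hRdeg : (∏ P ∈ T, P).natDegree ≤ n := hn ▸ natDegree_le_of_dvd hRdvd hF.ne_zero
  have hRpos : 0 < (∏ P ∈ T, P).natDegree :=
    (hSirr P₀ hP₀).trans_le (natDegree_le_of_dvd (Finset.dvd_prod_of_mem _ hP₀) hRm.ne_zero)
  have hRd : coeffDeriv K (∏ P ∈ T, P) ≠ 0 := fun h => hres <| by
    rw [h, resultant_zero_right, zero_pow hRpos.ne', zero_mul]
  have hbound := hRm.card_le_of_isNPowerful_two hRd hres B fun c hc => by
    obtain ⟨hc0, hcp⟩ := hpow c hc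
    have hu : derivative ((∏ P ∈ T₀, P ^ S.count P).eval (C c)) = 0 := by
      rw [← eval_C_coeffDeriv, hconst, eval_zero]
    have heval : (∏ P ∈ T, P ^ S.count P).eval (C c) = ∏ P ∈ T, P.eval (C c) ^ S.count P := by
      simp only [eval_prod, eval_pow]
    rw [hprod, eval_mul, eq_C_of_derivative_eq_zero hu, heval] at hc0 hcp
    rw [eval_prod]
    exact isNPowerful_two_of_prod_pow T (eval (C c)) (S.count ·)
      (fun P hP => ⟨Multiset.count_pos.mpr (hTS P hP), hcount P hP⟩) _ hc0 hcp
  nlinarith [Nat.le_self_pow two_ne_zero n, Nat.pow_le_pow_left hRdeg 2]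

end Polynomial

theorem buchi_theorem_polynomial_ring_powerful
    {K : Type*} [Field K] [IsAlgClosed K] [CharZero K]
    (n : ℕ) (hn : 2 ≤ n)
    (a : Fin n → Polynomial K)
    (B : Finset K)
    (hB : 2 * n ^ 2 * (n + 1) * Nat.choose (3 * n - 1) n ≤ B.card)
    (hpow : ∀ lam ∈ B,
      Polynomial.eval ((C lam : Polynomial K))
        (X ^ n + ∑ i : Fin n, C (a i) * X ^ (i : ℕ) : Polynomial (Polynomial K)) ≠ 0 ∧
      Polynomial.IsNPowerful n (Polynomial.eval ((C lam : Polynomial K))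
        (X ^ n + ∑ i : Fin n, C (a i) * X ^ (i : ℕ) : Polynomial (Polynomial K)))) :
    (∀ i, ∃ k : K, a i = C k) ∨
    ∃ ν : Polynomial K,
      (X ^ n + ∑ i : Fin n, C (a i) * X ^ (i : ℕ) : Polynomial (Polynomial K))
        = (X + C ν) ^ n := by
  have hlt : (∑ i : Fin n, C (a i) * X ^ (i : ℕ) : Polynomial (Polynomial K)).degree < n :=
    degree_sum_fin_lt a
  have hdeg : (X ^ n + ∑ i : Fin n, C (a i) * X ^ (i : ℕ) :
      Polynomial (Polynomial K)).natDegree = n :=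
    natDegree_eq_of_degree_eq_some
      ((degree_add_eq_left_of_degree_lt (by rwa [degree_X_pow])).trans (degree_X_pow n))
  have hcard : 5 * n ^ 2 < B.card := by
    have hchoose : 0 < Nat.choose (3 * n - 1) n := Nat.choose_pos (by omega)
    refine lt_of_lt_of_le ?_ ((Nat.le_mul_of_pos_right _ hchoose).trans hB)
    nlinarith
  refine ((monic_X_pow_add hlt).coeffDeriv_eq_zero_or_eq_pow hdeg B hcard hpow).imp_left
    fun h i => ?_
  have hi := congrArg (coeff · (i : ℕ)) h
  have hcoeff : (X ^ n + ∑ i : Fin n, C (a i) * X ^ (i : ℕ) : Polynomial (Polynomial K)).coeff i =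
      a i := by
    simp [finsetSum_coeff, coeff_X_pow, i.isLt.ne, Fin.val_inj]
  simp only [coeff_coeffDeriv, hcoeff, coeff_zero] at hi
  exact ⟨_, eq_C_of_derivative_eq_zero hi⟩
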